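/- arXiv:2510.06141 — 8 statements merged into one kernel-verified Lean document; each statement's English description precedes it below -/
import Mathlib

section
/- Let Z : Ω → ℝ^d be a random vector on a probability space, G a sub-σ-algebra, and σ > 0. Assume E[Z | G] = 0 almost surely and E[exp(‖Z‖²/σ²) | G] ≤ e almost surely. Then for every G-measurable random vector V : Ω → ℝ^d, one has E[exp(⟨V, Z⟩) | G] ≤ exp(3σ²‖V‖²/4) almost surely. -/
open MeasureTheory
open scoped RealInnerProductSpace

lemma bern {p s : ℝ} (h0 : 0 ≤ p) (h1 : p ≤ 1) : Real.exp (p * s) ≤ 1 - p + p * Real.exp s := by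
  have := convexOn_exp.2 (Set.mem_univ 0) (Set.mem_univ s) (sub_nonneg.2 h1) h0 (by ring)
  simpa using this

lemma exp_up {x : ℝ} (h0 : 0 ≤ x) (h1 : x ≤ 16/9) :
    Real.exp x ≤ 1 + x + x^2/2 + x^3/6 + x^4/24 + x^5/120 + x^6/360 := by
  have h := Complex.exp_bound' (x := (x:ℂ)) (n := 6) (by
    rw [Complex.norm_real, Real.norm_of_nonneg h0]; norm_num; linarith)
  have h2 : Complex.exp x - ∑ m ∈ Finset.range 6, (x:ℂ)^m / m.factorial
     = ((Real.exp x - ∑ m ∈ Finset.range 6, x^m / m.factorial : ℝ) : ℂ) := by push_cast; rfl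
  rw [h2, Complex.norm_real, Complex.norm_real, Real.norm_of_nonneg h0] at h
  have h3 := (le_abs_self _).trans h
  simp [Finset.sum_range_succ, Nat.factorial] at h3
  linarith

lemma exp_lo {y : ℝ} (h0 : 0 ≤ y) : 1 + y + y^2/2 + y^3/6 ≤ Real.exp y := by
  have := Real.sum_le_exp_of_nonneg h0 4
  simp [Finset.sum_range_succ, Nat.factorial] at this
  linarith

lemma exp_neg_up {x : ℝ} (h : x ≤ 0) : Real.exp x ≤ 1 + x + x^2/2 := by
  have h1 := exp_lo (y := -x) (by linarith)
  have h2 : Real.exp x * Real.exp (-x) = 1 := by rw [← Real.exp_add]; simp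
  have h3 := Real.exp_pos x
  have h4 : 0 < 1 + x + x^2/2 := by nlinarith [sq_nonneg (x+1)]
  have h5 : 1 ≤ (1 + x + x^2/2) * (1 + -x + (-x)^2/2 + (-x)^3/6) := by
    have e : (1 + x + x^2/2) * (1 + -x + (-x)^2/2 + (-x)^3/6) - 1 = (-x)^3 * (1/6 + (-x)*(1 /12) + (-x)^2/12) := by ring
    have : 0 ≤ (-x)^3 * (1/6 + (-x)*(1 /12) + (-x)^2/12) := by
      have : 0 ≤ -x := by linarith
      positivity
    linarith
  have h6 : 1 ≤ (1 + x + x^2/2) * Real.exp (-x) := h5.trans (by gcongr)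
  nlinarith

lemma exp_key (x : ℝ) : Real.exp x ≤ x + Real.exp (9/16 * x^2) := by
  rcases le_total x 0 with h | h
  · have := exp_neg_up h
    have := Real.add_one_le_exp (9/16 * x^2)
    nlinarith [sq_nonneg x]
  rcases le_total x (16/9) with h' | h'
  · have h1 := exp_up h h'
    have h2 := exp_lo (y := 9/16*x^2) (by positivity)
    have h3 : 0 ≤ 1/16 - x/6 + (81/512-1/24)*x^2 - x^3/120 + (729/24576-1/360)*x^4 := by
      nlinarith [sq_nonneg (x^2 - 1/6*x), sq_nonneg (x^2+x/5-2/5), sq_nonneg (x-5/8), sq_nonneg (x^2 - x/4),sq_nonneg (x-11/20), sq_nonneg (x^2-3/10)]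
    have h4 := mul_nonneg (sq_nonneg x) h3
    linarith
  · have : Real.exp x ≤ Real.exp (9/16*x^2) := Real.exp_le_exp.2 (by nlinarith)
    linarith

lemma ptwise {d : ℕ} {σ : ℝ} (hσ : 0 < σ) (v z : EuclideanSpace ℝ (Fin d)) :
    (9/16 * (σ^2*‖v‖^2) ≤ 1 → Real.exp ⟪v, z⟫ ≤ ⟪v, z⟫ + Real.exp (9/16 * (σ^2*‖v‖^2)) *
      (1 - 9/16 * (σ^2*‖v‖^2) + 9/16 * (σ^2*‖v‖^2) * (Real.exp (-1) * Real.exp (‖z‖^2/σ^2)))) ∧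
    (Real.exp ⟪v, z⟫ ≤ Real.exp (3/8 * (σ^2*‖v‖^2) + 2/3) *
      (1 - 2/3 + 2/3 * (Real.exp (-1) * Real.exp (‖z‖^2/σ^2)))) := by
  have hx : |⟪v, z⟫| ≤ ‖v‖ * ‖z‖ := abs_real_inner_le_norm v z
  set t := ‖z‖^2/σ^2 with ht
  set a := σ^2*‖v‖^2 with ha
  have hat : (‖v‖*‖z‖)^2 = a * t := by rw [ha, ht]; field_simp
  have ha0 : 0 ≤ a := by positivity
  have e1 : Real.exp (-1) * Real.exp t = Real.exp (t - 1) := by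
    rw [← Real.exp_add]; ring_nf
  rw [e1]
  have hx2 : ⟪v, z⟫^2 ≤ a * t := by
    rw [← hat, ← sq_abs]; gcongr
  constructor
  · intro hA
    refine (exp_key _).trans ?_
    gcongr
    calc Real.exp (9/16 * ⟪v, z⟫^2) ≤ Real.exp (9/16 * a + 9/16 * a * (t-1)) := by
          apply Real.exp_le_exp.2; nlinarith
      _ = Real.exp (9/16 * a) * Real.exp (9/16 * a * (t-1)) := Real.exp_add _ _
      _ ≤ _ := by
        gcongr
        exact bern (by positivity) hA
  · have hle : ⟪v, z⟫ ≤ 3/8 * a + 2/3 * t := by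
      have ht0 : 0 ≤ t := by positivity
      refine (le_abs_self _).trans (abs_le_of_sq_le_sq ?_ (by positivity))
      nlinarith [sq_nonneg (3/8*a - 2/3*t)]
    calc Real.exp ⟪v, z⟫ ≤ Real.exp ((3/8 * a + 2/3) + 2/3 * (t-1)) := by
          apply Real.exp_le_exp.2; linarith
      _ = Real.exp (3/8 * a + 2/3) * Real.exp (2/3 * (t-1)) := Real.exp_add _ _
      _ ≤ _ := by
        gcongr
        exact bern (by norm_num) (by norm_num)

lemma exists_dom (d : ℕ) {σ : ℝ} (hσ : 0 < σ) :
    ∃ (c α β : EuclideanSpace ℝ (Fin d) → ℝ)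
      (w : EuclideanSpace ℝ (Fin d) → EuclideanSpace ℝ (Fin d)),
      Measurable c ∧ Measurable α ∧ Measurable β ∧ Measurable w ∧
      (∀ v, c v = Real.exp (-(3 * σ ^ 2 * ‖v‖ ^ 2 / 4))) ∧
      (∀ v, 0 ≤ α v) ∧ (∀ v, 0 ≤ β v) ∧
      (∀ v, α v + β v * Real.exp 1 ≤ 1) ∧ (∀ v, ‖w v‖ ≤ 4/(3*σ)) ∧
      ∀ v z, c v * Real.exp ⟪v, z⟫ ≤ ⟪w v, z⟫ + α v + β v * Real.exp (‖z‖^2/σ^2) := by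
  classical
  let a : EuclideanSpace ℝ (Fin d) → ℝ := fun v => σ^2*‖v‖^2
  have ha : Measurable a := by fun_prop
  have ha0 : ∀ v, 0 ≤ a v := fun v => by positivity
  let c : EuclideanSpace ℝ (Fin d) → ℝ := fun v => Real.exp (-(3 * σ ^ 2 * ‖v‖ ^ 2 / 4))
  have hc : Measurable c := by fun_prop
  have hS : MeasurableSet {v | 9/16 * a v ≤ 1} := measurableSet_le (by fun_prop) (by fun_prop)
  let q : EuclideanSpace ℝ (Fin d) → ℝ := fun v => if 9/16 * a v ≤ 1 then 9/16 * a v else 2/3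
  let k : EuclideanSpace ℝ (Fin d) → ℝ :=
    fun v => if 9/16 * a v ≤ 1 then 9/16 * a v else 3/8 * a v + 2/3
  let w : EuclideanSpace ℝ (Fin d) → EuclideanSpace ℝ (Fin d) :=
    fun v => if 9/16 * a v ≤ 1 then c v • v else 0
  have hq : Measurable q := Measurable.ite hS (by fun_prop) (by fun_prop)
  have hk : Measurable k := Measurable.ite hS (by fun_prop) (by fun_prop)
  have hw : Measurable w := Measurable.ite hS (by fun_prop) (by fun_prop)
  have hq0 : ∀ v, 0 ≤ q v := fun v => by
    have := ha0 v
    simp only [q]; split_ifs <;> positivity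
  have hq1 : ∀ v, q v ≤ 1 := fun v => by
    simp only [q]; split_ifs
    · assumption
    · norm_num
  have hkc : ∀ v, c v * Real.exp (k v) ≤ 1 := fun v => by
    have := ha0 v
    have h3 : 3 * σ ^ 2 * ‖v‖ ^ 2 / 4 = 3/4 * a v := by simp only [a]; ring
    simp only [c]
    rw [← Real.exp_add, Real.exp_le_one_iff, h3]
    simp only [k]; split_ifs with h <;> linarith
  have hc0 : ∀ v, 0 < c v := fun v => Real.exp_pos _
  have hc1 : ∀ v, c v ≤ 1 := fun v => by
    simp only [c]; rw [Real.exp_le_one_iff]; simp; positivity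
  refine ⟨c, fun v => c v * Real.exp (k v) * (1 - q v),
    fun v => c v * Real.exp (k v) * (q v * Real.exp (-1)), w, hc, by fun_prop, by fun_prop, hw,
    fun v => rfl, fun v => ?_, fun v => ?_, fun v => ?_, fun v => ?_, fun v z => ?_⟩
  · have := hc0 v; have := hq1 v
    exact mul_nonneg (by positivity) (by linarith)
  · have := hc0 v; have := hq0 v
    positivity
  · have e : Real.exp (-1) * Real.exp 1 = 1 := by rw [← Real.exp_add]; simp
    have := hkc v
    calc _ = c v * Real.exp (k v) * (1 - q v + q v * (Real.exp (-1) * Real.exp 1)) := by ring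
      _ = c v * Real.exp (k v) := by rw [e]; ring
      _ ≤ 1 := this
  · simp only [w]; split_ifs with h
    · rw [norm_smul, Real.norm_of_nonneg (hc0 v).le]
      have h1 : ‖v‖ ≤ 4/(3*σ) := by
        rw [le_div_iff₀ (by positivity)]
        simp only [a] at h
        exact (le_abs_self _).trans
          (abs_le_of_sq_le_sq (a := ‖v‖ * (3*σ)) (b := 4) (by nlinarith) (by norm_num))
      calc c v * ‖v‖ ≤ 1 * ‖v‖ := by gcongr; exact hc1 v
        _ ≤ _ := by rw [one_mul]; exact h1
    · simp; positivity
  · obtain ⟨p1, p2⟩ := ptwise hσ v z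
    have := hc0 v
    simp only [w, k, q]
    split_ifs with h
    · have := mul_le_mul_of_nonneg_left (p1 h) this.le
      refine this.trans (le_of_eq ?_)
      rw [real_inner_smul_left]; simp only [a]; ring
    · have := mul_le_mul_of_nonneg_left p2 this.le
      refine this.trans (le_of_eq ?_)
      rw [inner_zero_left]; simp only [a]; ring

/-- Conditional MGF bound for the inner product with a conditionally sub-Gaussian,
conditionally zero-mean random vector (Lemma 2, part 1). -/
theorem condexp_exp_inner_le_of_subGaussian
    {d : ℕ} {Ω : Type*} {mΩ : MeasurableSpace Ω} {μ : Measure Ω} [IsProbabilityMeasure μ]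
    {G : MeasurableSpace Ω} (hG : G ≤ mΩ)
    (Z : Ω → EuclideanSpace ℝ (Fin d)) (hZmeas : Measurable Z)
    (σ : ℝ) (hσ : 0 < σ)
    (hZint : Integrable Z μ)
    (hmean : μ[Z | G] =ᵐ[μ] 0)
    (hexpint : Integrable (fun ω => Real.exp (‖Z ω‖ ^ 2 / σ ^ 2)) μ)
    (hsubG : μ[fun ω => Real.exp (‖Z ω‖ ^ 2 / σ ^ 2) | G] ≤ᵐ[μ] fun _ => Real.exp 1) :
    ∀ V : Ω → EuclideanSpace ℝ (Fin d), StronglyMeasurable[G] V →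
      Integrable (fun ω => Real.exp (⟪V ω, Z ω⟫)) μ →
      μ[fun ω => Real.exp (⟪V ω, Z ω⟫) | G] ≤ᵐ[μ]
        fun ω => Real.exp (3 * σ ^ 2 * ‖V ω‖ ^ 2 / 4) := by
  intro V hV hint
  obtain ⟨c, α, β, w, hc, hα, hβ, hw, hcv, hα0, hβ0, hab, hwb, hdom⟩ := exists_dom d hσ
  have hVm : Measurable[G] V := hV.measurable
  have hcV : StronglyMeasurable[G] (fun ω => c (V ω)) := (hc.comp hVm).stronglyMeasurable
  have hαV : StronglyMeasurable[G] (fun ω => α (V ω)) := (hα.comp hVm).stronglyMeasurable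
  have hβV : StronglyMeasurable[G] (fun ω => β (V ω)) := (hβ.comp hVm).stronglyMeasurable
  have hwV : StronglyMeasurable[G] (fun ω => w (V ω)) := (hw.comp hVm).stronglyMeasurable
  have hα1 : ∀ v, α v ≤ 1 := fun v => by
    have := hab v; have := mul_nonneg (hβ0 v) (Real.exp_pos 1).le; linarith
  have hβ1 : ∀ v, β v ≤ 1 := fun v => by
    have := hab v; have := hα0 v; have := hβ0 v
    have := Real.add_one_le_exp (1:ℝ); nlinarith
  have i1 : Integrable (fun ω => c (V ω) * Real.exp ⟪V ω, Z ω⟫) μ := by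
    refine hint.bdd_mul (c := 1) (hcV.mono hG).aestronglyMeasurable (ae_of_all _ fun ω => ?_)
    rw [hcv, Real.norm_of_nonneg (Real.exp_pos _).le, Real.exp_le_one_iff]
    simp; positivity
  have i2 : Integrable (fun ω => β (V ω) * Real.exp (‖Z ω‖ ^ 2 / σ ^ 2)) μ := by
    refine hexpint.bdd_mul (c := 1) (hβV.mono hG).aestronglyMeasurable (ae_of_all _ fun ω => ?_)
    rw [Real.norm_of_nonneg (hβ0 _)]; exact hβ1 _
  have i3 : Integrable (fun ω => α (V ω)) μ := by
    refine Integrable.of_bound (hαV.mono hG).aestronglyMeasurable 1 (ae_of_all _ fun ω => ?_)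
    rw [Real.norm_of_nonneg (hα0 _)]; exact hα1 _
  have i4 : Integrable (fun ω => ⟪w (V ω), Z ω⟫) μ := by
    refine (hZint.norm.const_mul (4/(3*σ))).mono'
      ((hwV.mono hG).aestronglyMeasurable.inner hZint.aestronglyMeasurable)
      (ae_of_all _ fun ω => ?_)
    refine (norm_inner_le_norm _ _).trans ?_
    gcongr
    exact hwb _
  have e1 : μ[fun ω => c (V ω) * Real.exp ⟪V ω, Z ω⟫ | G] =ᵐ[μ]
      (fun ω => c (V ω)) * μ[fun ω => Real.exp ⟪V ω, Z ω⟫ | G] :=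
    condExp_mul_of_stronglyMeasurable_left hcV i1 hint
  have e2 : μ[fun ω => β (V ω) * Real.exp (‖Z ω‖ ^ 2 / σ ^ 2) | G] =ᵐ[μ]
      (fun ω => β (V ω)) * μ[fun ω => Real.exp (‖Z ω‖ ^ 2 / σ ^ 2) | G] :=
    condExp_mul_of_stronglyMeasurable_left hβV i2 hexpint
  have e3 : μ[fun ω => α (V ω) | G] = fun ω => α (V ω) :=
    condExp_of_stronglyMeasurable hG hαV i3
  have e4 : μ[fun ω => ⟪w (V ω), Z ω⟫ | G] =ᵐ[μ] fun ω => ⟪w (V ω), μ[Z | G] ω⟫ :=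
    condExp_bilin_of_stronglyMeasurable_left (innerSL ℝ) hwV i4 hZint
  have m := condExp_mono (m := G) i1 ((i4.add i3).add i2) (ae_of_all _ fun ω => hdom (V ω) (Z ω))
  have a1 := condExp_add (i4.add i3) i2 G
  have a2 := condExp_add i4 i3 G
  filter_upwards [e1, e2, e4, m, a1, a2, hmean, hsubG] with ω e1 e2 e4 m a1 a2 h0 hs
  rw [e1, a1, Pi.add_apply, a2, Pi.add_apply, e2, e4, h0, e3] at m
  simp only [Pi.mul_apply, Pi.zero_apply, inner_zero_right, zero_add] at m
  have h1 := mul_le_mul_of_nonneg_left hs (hβ0 (V ω))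
  have h2 := hab (V ω)
  rw [hcv, Real.exp_neg] at m
  have h3 := m.trans ((add_le_add_right h1 _).trans h2)
  rwa [inv_mul_le_iff₀ (Real.exp_pos _), mul_one] at h3
end

section
/- Let Z_1, …, Z_n : Ω → ℝ^d be random vectors on a probability space and G a sub-σ-algebra. Assume that, conditioned on G, the Z_i are independent and E[exp(‖Z_i‖²/σ_i²) | G] ≤ e almost surely, for constants σ_i > 0. Let Z̄ = (1/n)∑_{i=1}^n Z_i and σ² = (1/n)∑_{i=1}^n σ_i². Then E[exp(‖Z̄‖²/σ²) | G] ≤ e almost surely, i.e., Z̄ is σ-sub-Gaussian conditioned on G. -/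
open MeasureTheory ProbabilityTheory

/-- The average of `n` conditionally independent, conditionally sub-Gaussian random vectors
with parameters `σᵢ` is `σ`-sub-Gaussian conditioned on `G`, where
`σ² = (1/n) ∑ᵢ σᵢ²` (direct bound without variance reduction). -/
theorem avg_noise_subGaussian_direct
    {d n : ℕ} (hn : 0 < n)
    {Ω : Type*} {mΩ : MeasurableSpace Ω} [StandardBorelSpace Ω]
    {μ : Measure Ω} [IsProbabilityMeasure μ]
    {G : MeasurableSpace Ω} (hG : G ≤ mΩ)
    (Z : Fin n → Ω → EuclideanSpace ℝ (Fin d)) (hZmeas : ∀ i, Measurable (Z i))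
    (σs : Fin n → ℝ) (hσs : ∀ i, 0 < σs i)
    (hindep : iCondIndepFun G hG Z μ)
    (hexpint : ∀ i, Integrable (fun ω => Real.exp (‖Z i ω‖ ^ 2 / (σs i) ^ 2)) μ)
    (hsubG : ∀ i, μ[fun ω => Real.exp (‖Z i ω‖ ^ 2 / (σs i) ^ 2) | G] ≤ᵐ[μ]
      fun _ => Real.exp 1)
    (Zbar : Ω → EuclideanSpace ℝ (Fin d))
    (hZbar : Zbar = fun ω => (n : ℝ)⁻¹ • ∑ i, Z i ω)
    (σ2 : ℝ) (hσ2 : σ2 = (1 / n : ℝ) * ∑ i, (σs i) ^ 2) :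
    μ[fun ω => Real.exp (‖Zbar ω‖ ^ 2 / σ2) | G] ≤ᵐ[μ] fun _ => Real.exp 1 := by
  have hn' : (0:ℝ) < n := by exact_mod_cast hn
  have : Nonempty (Fin n) := ⟨⟨0, hn⟩⟩
  set S : ℝ := ∑ i, (σs i) ^ 2 with hS
  have hSpos : 0 < S := Finset.sum_pos (fun i _ => pow_pos (hσs i) 2) Finset.univ_nonempty
  have hσ2pos : 0 < σ2 := by rw [hσ2]; positivity
  set w : Fin n → ℝ := fun i => (σs i) ^ 2 / S with hw
  have hw0 : ∀ i, 0 ≤ w i := fun i => by positivity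
  have hw1 : ∑ i, w i = 1 := by
    simp only [hw]
    rw [← Finset.sum_div, ← hS, div_self hSpos.ne']
  set f : Fin n → Ω → ℝ := fun i ω => Real.exp (‖Z i ω‖ ^ 2 / (σs i) ^ 2) with hf
  have hpt : ∀ ω, Real.exp (‖Zbar ω‖ ^ 2 / σ2) ≤ ∑ i, w i * f i ω := by
    intro ω
    have h1 : ‖∑ i, Z i ω‖ ^ 2 ≤ n * ∑ i, ‖Z i ω‖ ^ 2 := by
      have h2 := sq_sum_le_card_mul_sum_sq (s := Finset.univ) (f := fun i => ‖Z i ω‖)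
      have h3 : ‖∑ i, Z i ω‖ ^ 2 ≤ (∑ i, ‖Z i ω‖) ^ 2 :=
        pow_le_pow_left₀ (norm_nonneg _) (norm_sum_le _ _) 2
      simp only [Finset.card_univ, Fintype.card_fin] at h2
      exact h3.trans h2
    have h4 : ‖Zbar ω‖ ^ 2 / σ2 ≤ ∑ i, w i * (‖Z i ω‖ ^ 2 / (σs i) ^ 2) := by
      have h5 : ∑ i, w i * (‖Z i ω‖ ^ 2 / (σs i) ^ 2) = (∑ i, ‖Z i ω‖ ^ 2) / S := by
        rw [Finset.sum_div]
        refine Finset.sum_congr rfl fun i _ => ?_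
        have := (hσs i).ne'
        simp only [hw]
        field_simp
      rw [h5, hZbar, hσ2]
      simp only [norm_smul, norm_inv, Real.norm_natCast]
      have h6 : ((n:ℝ)⁻¹ * ‖∑ i, Z i ω‖) ^ 2 / (1 / n * S) = (‖∑ i, Z i ω‖ ^ 2 / n) / S := by
        field_simp
      rw [h6]
      apply div_le_div_of_nonneg_right _ hSpos.le
      rw [div_le_iff₀ hn']
      linarith
    refine (Real.exp_le_exp.2 h4).trans ?_
    have := convexOn_exp.map_sum_le (t := Finset.univ) (w := w)
      (p := fun i => ‖Z i ω‖ ^ 2 / (σs i) ^ 2) (fun i _ => hw0 i) hw1 (fun i _ => Set.mem_univ _)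
    simpa [smul_eq_mul] using this
  have hint : ∀ i ∈ Finset.univ, Integrable (w i • f i) μ := fun i _ => (hexpint i).smul (w i)
  have hsumint : Integrable (∑ i, w i • f i) μ := integrable_finsetSum' _ hint
  have hZm : Measurable Zbar := by
    rw [hZbar]; fun_prop
  have hgint : Integrable (fun ω => Real.exp (‖Zbar ω‖ ^ 2 / σ2)) μ := by
    refine hsumint.mono' (Measurable.aestronglyMeasurable (by fun_prop)) (Filter.Eventually.of_forall fun ω => ?_)
    rw [Real.norm_of_nonneg (Real.exp_nonneg _)]
    simpa using hpt ω
  have hmono := condExp_mono (m := G) hgint hsumint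
    (Filter.Eventually.of_forall fun ω => by simpa using hpt ω)
  have hsum := condExp_finsetSum hint G
  have hsm : ∀ᵐ ω ∂μ, ∀ i, (μ[w i • f i | G]) ω = w i * (μ[f i | G]) ω := by
    rw [ae_all_iff]
    intro i
    filter_upwards [condExp_smul (w i) (f i) G (μ := μ)] with ω h
    simpa using h
  have hall := ae_all_iff.2 hsubG
  filter_upwards [hmono, hsum, hsm, hall] with ω a b c e
  refine a.trans ?_
  rw [b, Finset.sum_apply]
  calc ∑ i, (μ[w i • f i | G]) ω = ∑ i, w i * (μ[f i | G]) ω :=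
        Finset.sum_congr rfl fun i _ => c i
    _ ≤ ∑ i, w i * Real.exp 1 :=
        Finset.sum_le_sum fun i _ => mul_le_mul_of_nonneg_left (e i) (hw0 i)
    _ = Real.exp 1 := by rw [← Finset.sum_mul, hw1, one_mul]
end

section
/- Let f_1, …, f_n : ℝ^d → ℝ be differentiable functions each with L-Lipschitz continuous gradient, and let f = (1/n)∑_{i=1}^n f_i. Fix points x_1, …, x_n ∈ ℝ^d with average x̄ = (1/n)∑_{i=1}^n x_i, vectors z_1, …, z_n ∈ ℝ^d with average z̄ = (1/n)∑_{i=1}^n z_i, let ḡ = (1/n)∑_{i=1}^n (∇f_i(x_i) + z_i), and let 0 < α ≤ 1/(2L). Then f(x̄ − α ḡ) ≤ f(x̄) − (α/2)‖∇f(x̄)‖² − α⟨∇f(x̄), z̄⟩ + α²L‖z̄‖² + (αL²/(2n))∑_{i=1}^n ‖x_i − x̄‖². -/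
open scoped RealInnerProductSpace

theorem descent_aux {E : Type*} [NormedAddCommGroup E] [InnerProductSpace ℝ E] [CompleteSpace E]
    (G : E → ℝ) (g : E → E) (L : ℝ)
    (hG : ∀ x, HasGradientAt G (g x) x)
    (hlip : ∀ x y, ‖g x - g y‖ ≤ L * ‖x - y‖) (x v : E) :
    G (x + v) ≤ G x + ⟪g x, v⟫ + L / 2 * ‖v‖ ^ 2 := by
  have hd : ∀ t : ℝ, HasDerivAt
      (fun t : ℝ => G (x + t • v) - t * ⟪g x, v⟫ - L / 2 * ‖v‖ ^ 2 * t ^ 2)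
      (⟪g (x + t • v), v⟫ - ⟪g x, v⟫ - L * ‖v‖ ^ 2 * t) t := by
    intro t
    have h1 : HasDerivAt (fun t : ℝ => x + t • v) v t := by
      simpa using ((hasDerivAt_id t).smul_const v).const_add x
    have h2 : HasDerivAt (fun t : ℝ => G (x + t • v)) ⟪g (x + t • v), v⟫ t := by
      have := (hG (x + t • v)).hasFDerivAt.comp_hasDerivAt t h1
      simpa [Function.comp_def] using this
    have h3 := (hasDerivAt_id t).mul_const ⟪g x, v⟫
    have h4 := (hasDerivAt_pow 2 t).const_mul (L / 2 * ‖v‖ ^ 2)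
    refine ((h2.sub h3).sub h4).congr_deriv ?_
    simp
    ring
  have hanti := antitoneOn_of_deriv_nonpos (convex_Icc (0:ℝ) 1)
    (fun t _ => (hd t).continuousAt.continuousWithinAt)
    (fun t _ => (hd t).differentiableAt.differentiableWithinAt)
    (by
      intro t ht
      rw [interior_Icc] at ht
      rw [(hd t).deriv, ← inner_sub_left]
      have h1 := real_inner_le_norm (g (x + t • v) - g x) v
      have h2 := hlip (x + t • v) x
      rw [add_sub_cancel_left, norm_smul, Real.norm_eq_abs, abs_of_pos ht.1] at h2
      have h3 := mul_le_mul_of_nonneg_right h2 (norm_nonneg v)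
      nlinarith)
  have := hanti (by simp : (0:ℝ) ∈ Set.Icc (0:ℝ) 1) (by simp : (1:ℝ) ∈ Set.Icc (0:ℝ) 1) zero_le_one
  simp at this
  linarith

/-- Descent inequality for one averaged DSGD step (Lemma 1, deterministic form). -/
theorem dsgd_descent_inequality
    {d n : ℕ} (hn : 0 < n) (L : ℝ) (hL : 0 < L)
    (f : Fin n → EuclideanSpace ℝ (Fin d) → ℝ)
    (hdiff : ∀ i, Differentiable ℝ (f i))
    (hlip : ∀ i, ∀ x y, ‖gradient (f i) x - gradient (f i) y‖ ≤ L * ‖x - y‖)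
    (F : EuclideanSpace ℝ (Fin d) → ℝ)
    (hF : F = fun x => (1 / n : ℝ) * ∑ i, f i x)
    (x z : Fin n → EuclideanSpace ℝ (Fin d))
    (xbar zbar gbar : EuclideanSpace ℝ (Fin d))
    (hxbar : xbar = (n : ℝ)⁻¹ • ∑ i, x i)
    (hzbar : zbar = (n : ℝ)⁻¹ • ∑ i, z i)
    (hgbar : gbar = (n : ℝ)⁻¹ • ∑ i, (gradient (f i) (x i) + z i))
    (α : ℝ) (hα0 : 0 < α) (hα : α ≤ 1 / (2 * L)) :
    F (xbar - α • gbar) ≤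
      F xbar - (α / 2) * ‖gradient F xbar‖ ^ 2 - α * ⟪gradient F xbar, zbar⟫
        + α ^ 2 * L * ‖zbar‖ ^ 2
        + (α * L ^ 2 / (2 * n)) * ∑ i, ‖x i - xbar‖ ^ 2 := by
  have hn' : (0:ℝ) < n := by exact_mod_cast hn
  set g : EuclideanSpace ℝ (Fin d) → EuclideanSpace ℝ (Fin d) :=
    fun y => (n : ℝ)⁻¹ • ∑ i, gradient (f i) y with hg
  have hsumn : ∀ (u : Fin n → EuclideanSpace ℝ (Fin d)) (c : Fin n → ℝ),
      (∀ i, ‖u i‖ ≤ c i) → ‖(n : ℝ)⁻¹ • ∑ i, u i‖ ≤ (n : ℝ)⁻¹ * ∑ i, c i := by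
    intro u c h
    rw [norm_smul, Real.norm_eq_abs, abs_of_pos (inv_pos.2 hn')]
    exact mul_le_mul_of_nonneg_left (norm_sum_le_of_le _ fun i _ => h i) (inv_pos.2 hn').le
  have hG : ∀ y, HasGradientAt F (g y) y := by
    intro y
    have h := (HasFDerivAt.fun_sum (u := Finset.univ) (fun i _ =>
      ((hdiff i) y).hasGradientAt.hasFDerivAt)).const_mul (1 / n : ℝ)
    rw [hasGradientAt_iff_hasFDerivAt, hF]
    refine h.congr_fderiv ?_
    simp [hg]
  have hGl : ∀ y w, ‖g y - g w‖ ≤ L * ‖y - w‖ := by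
    intro y w
    have := hsumn (fun i => gradient (f i) y - gradient (f i) w) (fun _ => L * ‖y - w‖)
      (fun i => hlip i y w)
    rw [Finset.sum_sub_distrib, smul_sub] at this
    refine this.trans (le_of_eq ?_)
    simp
    field_simp
  rw [(hG xbar).gradient]
  set h := (n : ℝ)⁻¹ • ∑ i, gradient (f i) (x i) with hh
  have hgb : gbar = h + zbar := by
    rw [hgbar, hh, hzbar, Finset.sum_add_distrib, smul_add]
  have hgh : ‖g xbar - h‖ ^ 2 ≤ L ^ 2 / n * ∑ i, ‖x i - xbar‖ ^ 2 := by
    have h1 := hsumn (fun i => gradient (f i) xbar - gradient (f i) (x i))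
      (fun i => L * ‖x i - xbar‖)
      (fun i => by rw [norm_sub_rev (x i)]; exact hlip i _ _)
    rw [Finset.sum_sub_distrib, smul_sub, ← Finset.mul_sum] at h1
    have h2 := sq_sum_le_card_mul_sum_sq (s := Finset.univ) (f := fun i => ‖x i - xbar‖)
    simp only [Finset.card_univ, Fintype.card_fin] at h2
    calc ‖g xbar - h‖ ^ 2 ≤ ((n : ℝ)⁻¹ * (L * ∑ i, ‖x i - xbar‖)) ^ 2 :=
          pow_le_pow_left₀ (norm_nonneg _) h1 2
      _ = (L / n) ^ 2 * (∑ i, ‖x i - xbar‖) ^ 2 := by ring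
      _ ≤ (L / n) ^ 2 * (n * ∑ i, ‖x i - xbar‖ ^ 2) :=
          mul_le_mul_of_nonneg_left h2 (sq_nonneg _)
      _ = _ := by field_simp
  have hdesc := descent_aux F g L hG hGl xbar (-(α • gbar))
  rw [← sub_eq_add_neg, inner_neg_right, norm_neg, inner_smul_right, norm_smul,
    Real.norm_eq_abs, abs_of_pos hα0, hgb, inner_add_right] at hdesc
  rw [hgb]
  have e1 := norm_sub_sq_real (g xbar) h
  have e2 : ‖h + zbar‖ ^ 2 ≤ 2 * (‖h‖ ^ 2 + ‖zbar‖ ^ 2) := by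
    have := parallelogram_law_with_norm ℝ h zbar
    nlinarith [sq_nonneg ‖h - zbar‖]
  have e3 : α * L ≤ 1 / 2 := by
    rw [le_div_iff₀ (by positivity)] at hα
    linarith
  have e4 := mul_le_mul_of_nonneg_left e2 (by positivity : 0 ≤ L / 2 * α ^ 2)
  have e5 := mul_le_mul_of_nonneg_right e3 (by positivity : 0 ≤ α * ‖h‖ ^ 2)
  have e6 := mul_le_mul_of_nonneg_left hgh (by positivity : 0 ≤ α / 2)
  rw [e1] at e6
  have e7 : α / 2 * (L ^ 2 / n * ∑ i, ‖x i - xbar‖ ^ 2)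
    = (α * L ^ 2 / (2 * n)) * ∑ i, ‖x i - xbar‖ ^ 2 := by ring
  rw [e7] at e6
  linarith
end

section
/- Consider the DSGD iteration: x_i^{t+1} = ∑_{j=1}^n w_{ij}(x_j^t − α_t(∇f_j(x_j^t) + z_j^t)) for i = 1,…,n and t ≥ 1, where W = (w_{ij}) ∈ ℝ^{n×n} is doubly stochastic with λ := ‖W − J‖ ∈ [0,1) (J = (1/n)𝟙𝟙ᵀ, operator norm), α_k > 0 are step sizes, z_j^k ∈ ℝ^d are arbitrary vectors, and x̄^t = (1/n)∑_i x_i^t. Assume the bounded heterogeneity condition: for all x ∈ ℝ^d and all i, ‖∇f_i(x)‖² ≤ A² + B²‖∇f(x)‖², where f = (1/n)∑_i f_i and A, B ≥ 0. Let Δ_x = (1/n)∑_i ‖x_i^1 − x̄^1‖². Then for every t ≥ 1: (1/n)∑_{i=1}^n ‖x_i^{t+1} − x̄^{t+1}‖² ≤ 2λ^{2t}Δ_x + (4λ²/(n(1−λ)))∑_{k=1}^t α_k² λ^{t−k} ∑_{i=1}^n ‖z_i^k‖² + (4λ²A²/(1−λ))∑_{k=1}^t α_k² λ^{t−k} + (4λ²B²/(n(1−λ)))∑_{k=1}^t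 α_k² λ^{t−k} ∑_{i=1}^n ‖∇f(x_i^k)‖². -/
lemma aux_op {d n : ℕ} (M : Matrix (Fin n) (Fin n) ℝ) (y : Fin n → EuclideanSpace ℝ (Fin d)) :
    ∑ i, ‖∑ j, M i j • y j‖ ^ 2 ≤ ‖Matrix.toEuclideanCLM (𝕜 := ℝ) M‖ ^ 2 * ∑ j, ‖y j‖ ^ 2 := by
  have h : ∀ c : Fin d, ∑ i, (∑ j, M i j * y j c) ^ 2 ≤
      ‖Matrix.toEuclideanCLM (𝕜 := ℝ) M‖ ^ 2 * ∑ j, (y j c) ^ 2 := by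
    intro c
    have h1 := (Matrix.toEuclideanCLM (𝕜 := ℝ) M).le_opNorm (WithLp.toLp 2 fun j => y j c)
    have h2 := pow_le_pow_left₀ (norm_nonneg _) h1 2
    rw [mul_pow, EuclideanSpace.norm_sq_eq, EuclideanSpace.norm_sq_eq] at h2
    simpa [Matrix.mulVec, dotProduct] using h2
  simp only [EuclideanSpace.norm_sq_eq, Real.norm_eq_abs, sq_abs]
  rw [Finset.sum_comm, Finset.sum_comm (f := fun j c => (y j c) ^ 2), Finset.mul_sum]
  refine Finset.sum_le_sum fun c _ => ?_
  simpa using h c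

lemma aux_mink {d n : ℕ} (u v : Fin n → EuclideanSpace ℝ (Fin d)) (a : ℝ) (ha : 0 ≤ a) :
    √(∑ i, ‖u i - a • v i‖ ^ 2) ≤ √(∑ i, ‖u i‖ ^ 2) + a * √(∑ i, ‖v i‖ ^ 2) := by
  have h := norm_sub_le (WithLp.toLp 2 u : PiLp 2 fun _ : Fin n => EuclideanSpace ℝ (Fin d))
    (a • WithLp.toLp 2 v)
  rw [norm_smul, Real.norm_of_nonneg ha] at h
  simpa only [PiLp.norm_eq_of_L2, PiLp.sub_apply, PiLp.smul_apply] using h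

lemma aux_real (lam : ℝ) (h0 : 0 ≤ lam) (h1 : lam < 1) (s b : ℕ → ℝ)
    (hs : ∀ t, 0 ≤ s t)
    (hrec : ∀ t, 1 ≤ t → s (t + 1) ≤ lam * (s t + b t)) (t : ℕ) :
    s (t + 1) ^ 2 ≤ 2 * lam ^ (2 * t) * s 1 ^ 2 +
      2 * lam ^ 2 / (1 - lam) * ∑ k ∈ Finset.Icc 1 t, lam ^ (t - k) * b k ^ 2 := by
  have hl : 0 < 1 - lam := by linarith
  have key : ∀ t, s (t + 1) ≤ lam ^ t * s 1 + lam * ∑ k ∈ Finset.Icc 1 t, lam ^ (t - k) * b k := by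
    intro t
    induction t with
    | zero => simp
    | succ t ih =>
      rw [Finset.sum_Icc_succ_top (by omega)]
      have e : ∑ k ∈ Finset.Icc 1 t, lam ^ (t + 1 - k) * b k
          = lam * ∑ k ∈ Finset.Icc 1 t, lam ^ (t - k) * b k := by
        rw [Finset.mul_sum]
        refine Finset.sum_congr rfl fun k hk => ?_
        rw [Finset.mem_Icc] at hk
        rw [Nat.sub_add_comm hk.2, pow_succ]; ring
      rw [e]
      have := hrec (t + 1) (by omega)
      have h2 := mul_le_mul_of_nonneg_left ih h0
      simp only [Nat.sub_self, pow_zero, pow_succ]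
      nlinarith
  have geo : ∀ t, ∑ k ∈ Finset.Icc 1 t, lam ^ (t - k) ≤ 1 / (1 - lam) := by
    intro t
    rw [le_div_iff₀ hl]
    have : (∑ k ∈ Finset.Icc 1 t, lam ^ (t - k)) * (1 - lam) = 1 - lam ^ t := by
      induction t with
      | zero => simp
      | succ t ih =>
        rw [Finset.sum_Icc_succ_top (by omega)]
        have e : ∑ k ∈ Finset.Icc 1 t, lam ^ (t + 1 - k)
            = lam * ∑ k ∈ Finset.Icc 1 t, lam ^ (t - k) := by
          rw [Finset.mul_sum]
          refine Finset.sum_congr rfl fun k hk => ?_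
          rw [Finset.mem_Icc] at hk
          rw [Nat.sub_add_comm hk.2, pow_succ]; ring
        rw [e, add_mul, mul_assoc, ih]
        simp only [Nat.sub_self, pow_zero, pow_succ]
        ring
    rw [this]
    have := pow_nonneg h0 t
    linarith
  have cs : (∑ k ∈ Finset.Icc 1 t, lam ^ (t - k) * b k) ^ 2 ≤
      (∑ k ∈ Finset.Icc 1 t, lam ^ (t - k)) * ∑ k ∈ Finset.Icc 1 t, lam ^ (t - k) * b k ^ 2 := by
    apply Finset.sum_sq_le_sum_mul_sum_of_sq_eq_mul
    · intro i _; positivity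
    · intro i _; positivity
    · intro i _; ring
  have hV : 0 ≤ ∑ k ∈ Finset.Icc 1 t, lam ^ (t - k) * b k ^ 2 :=
    Finset.sum_nonneg fun i _ => by positivity
  have cs2 := cs.trans (mul_le_mul_of_nonneg_right (geo t) hV)
  have k2 := pow_le_pow_left₀ (hs _) (key t) 2
  set V := ∑ k ∈ Finset.Icc 1 t, lam ^ (t - k) * b k ^ 2
  set U := ∑ k ∈ Finset.Icc 1 t, lam ^ (t - k) * b k
  have k3 := mul_le_mul_of_nonneg_left cs2 (show 0 ≤ 2 * lam ^ 2 by positivity)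
  calc s (t + 1) ^ 2 ≤ (lam ^ t * s 1 + lam * U) ^ 2 := k2
    _ ≤ 2 * (lam ^ t * s 1) ^ 2 + 2 * (lam * U) ^ 2 := by
      nlinarith [sq_nonneg (lam ^ t * s 1 - lam * U)]
    _ = 2 * lam ^ (2 * t) * s 1 ^ 2 + 2 * lam ^ 2 * U ^ 2 := by rw [pow_mul']; ring
    _ ≤ 2 * lam ^ (2 * t) * s 1 ^ 2 + 2 * lam ^ 2 * (1 / (1 - lam) * V) := by linarith
    _ = _ := by ring


/-- Deterministic bound on the DSGD consensus gap under bounded heterogeneity (Lemma 3). -/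
theorem dsgd_consensus_gap_bound
    {d n : ℕ} (hn : 2 ≤ n)
    (W : Matrix (Fin n) (Fin n) ℝ)
    (hWpos : ∀ i j, 0 ≤ W i j)
    (hWrow : ∀ i, ∑ j, W i j = 1)
    (hWcol : ∀ j, ∑ i, W i j = 1)
    (J : Matrix (Fin n) (Fin n) ℝ) (hJ : J = Matrix.of fun _ _ => (1 / n : ℝ))
    (lam : ℝ) (hlam : lam = ‖Matrix.toEuclideanCLM (𝕜 := ℝ) (W - J)‖)
    (hlam1 : lam < 1)
    (f : Fin n → EuclideanSpace ℝ (Fin d) → ℝ)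
    (hdiff : ∀ i, Differentiable ℝ (f i))
    (F : EuclideanSpace ℝ (Fin d) → ℝ)
    (hF : F = fun x => (1 / n : ℝ) * ∑ i, f i x)
    (A B : ℝ) (hA : 0 ≤ A) (hB : 0 ≤ B)
    (hhet : ∀ x, ∀ i, ‖gradient (f i) x‖ ^ 2 ≤ A ^ 2 + B ^ 2 * ‖gradient F x‖ ^ 2)
    (α : ℕ → ℝ) (hα : ∀ t, 0 < α t)
    (z : ℕ → Fin n → EuclideanSpace ℝ (Fin d))
    (x : ℕ → Fin n → EuclideanSpace ℝ (Fin d))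
    (hrec : ∀ t : ℕ, 1 ≤ t → ∀ i,
      x (t + 1) i = ∑ j, W i j • (x t j - α t • (gradient (f j) (x t j) + z t j)))
    (xbar : ℕ → EuclideanSpace ℝ (Fin d))
    (hxbar : ∀ t, xbar t = (n : ℝ)⁻¹ • ∑ i, x t i)
    (Δx : ℝ) (hΔx : Δx = (1 / n : ℝ) * ∑ i, ‖x 1 i - xbar 1‖ ^ 2) :
    ∀ t : ℕ, 1 ≤ t →
      (1 / n : ℝ) * ∑ i, ‖x (t + 1) i - xbar (t + 1)‖ ^ 2 ≤
        2 * lam ^ (2 * t) * Δx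
          + (4 * lam ^ 2 / (n * (1 - lam))) *
              ∑ k ∈ Finset.Icc 1 t, (α k) ^ 2 * lam ^ (t - k) * ∑ i, ‖z k i‖ ^ 2
          + (4 * lam ^ 2 * A ^ 2 / (1 - lam)) *
              ∑ k ∈ Finset.Icc 1 t, (α k) ^ 2 * lam ^ (t - k)
          + (4 * lam ^ 2 * B ^ 2 / (n * (1 - lam))) *
              ∑ k ∈ Finset.Icc 1 t, (α k) ^ 2 * lam ^ (t - k) *
                ∑ i, ‖gradient F (x k i)‖ ^ 2 := by
  intro t ht
  have hn0 : (0 : ℝ) < n := by exact_mod_cast (by omega : 0 < n)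
  have h0 : 0 ≤ lam := hlam ▸ norm_nonneg _
  have hl : 0 < 1 - lam := by linarith
  let g : ℕ → Fin n → EuclideanSpace ℝ (Fin d) := fun k j => gradient (f j) (x k j) + z k j
  have hdev : ∀ k, 1 ≤ k → ∀ i, x (k + 1) i - xbar (k + 1) =
      ∑ j, (W - J) i j • ((x k j - xbar k) - α k • g k j) := by
    intro k hk i
    have e1 : xbar (k + 1) = ∑ j, (n : ℝ)⁻¹ • (x k j - α k • g k j) := by
      rw [hxbar, ← Finset.smul_sum]
      congr 1
      rw [Finset.sum_congr rfl fun i _ => hrec k hk i, Finset.sum_comm]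
      refine Finset.sum_congr rfl fun j _ => ?_
      rw [← Finset.sum_smul, hWcol, one_smul]
    have e2 : ∑ j, (W - J) i j = 0 := by
      simp [hJ, Matrix.sub_apply, Finset.sum_sub_distrib, hWrow, hn0.ne']
    have e3 : ∀ j, (W - J) i j • ((x k j - xbar k) - α k • g k j)
        = (W i j • (x k j - α k • g k j) - (n : ℝ)⁻¹ • (x k j - α k • g k j))
          - (W - J) i j • xbar k := by
      intro j
      rw [← sub_smul]
      have : (W - J) i j = W i j - (n : ℝ)⁻¹ := by simp [hJ]
      rw [this, ← smul_sub]
      congr 1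
      abel
    rw [Finset.sum_congr rfl fun j _ => e3 j, Finset.sum_sub_distrib, Finset.sum_sub_distrib,
      ← Finset.sum_smul, e2, zero_smul, sub_zero, ← e1, hrec k hk i]
  let s : ℕ → ℝ := fun k => √(∑ i, ‖x k i - xbar k‖ ^ 2)
  have hsq : ∀ k, s k ^ 2 = ∑ i, ‖x k i - xbar k‖ ^ 2 := fun k =>
    Real.sq_sqrt (Finset.sum_nonneg fun i _ => by positivity)
  let b : ℕ → ℝ := fun k => α k * √(∑ i, ‖g k i‖ ^ 2)
  have hbsq : ∀ k, b k ^ 2 = α k ^ 2 * ∑ i, ‖g k i‖ ^ 2 := fun k => by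
    simp only [b]
    rw [mul_pow, Real.sq_sqrt (Finset.sum_nonneg fun i _ => by positivity)]
  have hs : ∀ k, 1 ≤ k → s (k + 1) ≤ lam * (s k + b k) := by
    intro k hk
    have h1 : s (k + 1) ≤ lam * √(∑ j, ‖(x k j - xbar k) - α k • g k j‖ ^ 2) := by
      apply Real.sqrt_le_iff.2
      refine ⟨by positivity, ?_⟩
      rw [mul_pow, Real.sq_sqrt (Finset.sum_nonneg fun i _ => by positivity),
        Finset.sum_congr rfl fun i _ => by rw [hdev k hk i], hlam]
      exact aux_op _ _
    exact h1.trans (mul_le_mul_of_nonneg_left (aux_mink _ _ _ (hα k).le) h0)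
  have main := aux_real lam h0 hlam1 s b (fun k => Real.sqrt_nonneg _) hs t
  have hg : ∀ k, ∑ i, ‖g k i‖ ^ 2 ≤ 2 * ∑ i, ‖z k i‖ ^ 2 + 2 * (n * A ^ 2)
      + 2 * (B ^ 2 * ∑ i, ‖gradient F (x k i)‖ ^ 2) := by
    intro k
    have : ∀ i, ‖g k i‖ ^ 2 ≤ 2 * ‖z k i‖ ^ 2 + 2 * A ^ 2
        + 2 * (B ^ 2 * ‖gradient F (x k i)‖ ^ 2) := by
      intro i
      have a1 := pow_le_pow_left₀ (norm_nonneg _) (norm_add_le (gradient (f i) (x k i)) (z k i)) 2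
      have a2 := hhet (x k i) i
      simp only [g]
      nlinarith [sq_nonneg (‖gradient (f i) (x k i)‖ - ‖z k i‖)]
    refine (Finset.sum_le_sum fun i _ => this i).trans (le_of_eq ?_)
    simp only [Finset.sum_add_distrib, ← Finset.mul_sum, Finset.sum_const, Finset.card_univ,
      Fintype.card_fin, nsmul_eq_mul]
  have hV : ∑ k ∈ Finset.Icc 1 t, lam ^ (t - k) * b k ^ 2 ≤
      2 * (∑ k ∈ Finset.Icc 1 t, (α k) ^ 2 * lam ^ (t - k) * ∑ i, ‖z k i‖ ^ 2)
      + 2 * (n * A ^ 2) * (∑ k ∈ Finset.Icc 1 t, (α k) ^ 2 * lam ^ (t - k))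
      + 2 * B ^ 2 * (∑ k ∈ Finset.Icc 1 t, (α k) ^ 2 * lam ^ (t - k) *
                ∑ i, ‖gradient F (x k i)‖ ^ 2) := by
    rw [Finset.mul_sum, Finset.mul_sum, Finset.mul_sum, ← Finset.sum_add_distrib,
      ← Finset.sum_add_distrib]
    refine Finset.sum_le_sum fun k _ => ?_
    rw [hbsq]
    have := mul_le_mul_of_nonneg_left (hg k)
      (show 0 ≤ lam ^ (t - k) * α k ^ 2 by positivity)
    linarith
  rw [hsq, hsq] at main
  have m2 := main.trans (add_le_add_right (mul_le_mul_of_nonneg_left hV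
    (show 0 ≤ 2 * lam ^ 2 / (1 - lam) by positivity)) _)
  refine (mul_le_mul_of_nonneg_left m2 (show (0 : ℝ) ≤ 1 / n by positivity)).trans (le_of_eq ?_)
  rw [hΔx]
  generalize (∑ k ∈ Finset.Icc 1 t, (α k) ^ 2 * lam ^ (t - k) * ∑ i, ‖z k i‖ ^ 2) = Z
  generalize (∑ k ∈ Finset.Icc 1 t, (α k) ^ 2 * lam ^ (t - k) *
                ∑ i, ‖gradient F (x k i)‖ ^ 2) = Y
  generalize (∑ k ∈ Finset.Icc 1 t, (α k) ^ 2 * lam ^ (t - k)) = X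
  have := hn0.ne'
  have := hl.ne'
  field_simp
  ring
end

section
/- Let a ∈ (1, 2], t_0 ≥ a, M ∈ ℕ, and C_1, …, C_M > 0. Let X^1 > 0 be a deterministic real number and {X^t}_{t ≥ 2} real random variables on a probability space such that for every t ≥ 1: E[exp(X^{t+1})] ≤ E[exp((1 − a/(t+t_0))X^t + ∑_{i=1}^M C_i/(t+t_0)^i)]. Then for every t ≥ 1: E[exp(X^{t+1})] ≤ exp( (t_0+1)^a X^1/(t+1+t_0)^a + 2^a C_1/a + 2^a C_2/((a−1)(t+1+t_0)) + 2^a C_3 log(t+1+t_0)/(t+1+t_0)^a + ∑_{j=4}^M 2^a t_0^{3−j} C_j/((j−3)(t+1+t_0)^a) ), where terms C_i with index exceeding M are absent. -/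
open MeasureTheory

lemma aux_jensen {Ω : Type*} {mΩ : MeasurableSpace Ω} (μ : Measure Ω) [IsProbabilityMeasure μ]
    (Y : Ω → ℝ) (hY : Integrable (fun ω => Real.exp (Y ω)) μ) (l b c : ℝ) (h0 : 0 ≤ l) (h1 : l ≤ 1)
    (hb : ∫ ω, Real.exp (Y ω) ∂μ ≤ Real.exp b) :
    ∫ ω, Real.exp (l * Y ω + c) ∂μ ≤ Real.exp (l * b + c) := by
  have key : ∀ ω, Real.exp (l * Y ω + c) ≤
      Real.exp (l * b + c) * ((1 - l) + l * Real.exp (-b) * Real.exp (Y ω)) := by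
    intro ω
    have := convexOn_exp.2 (Set.mem_univ (0:ℝ)) (Set.mem_univ (Y ω - b))
      (sub_nonneg.2 h1) h0 (by ring)
    simp only [smul_eq_mul, mul_zero, zero_add, Real.exp_zero, mul_one] at this
    have e : l * Y ω + c = (l * b + c) + l * (Y ω - b) := by ring
    rw [e, Real.exp_add]
    refine mul_le_mul_of_nonneg_left (this.trans_eq ?_) (Real.exp_pos _).le
    rw [sub_eq_add_neg (Y ω) b, Real.exp_add]; ring
  have hi : Integrable (fun ω => (1 - l) + l * Real.exp (-b) * Real.exp (Y ω)) μ :=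
    (integrable_const _).add (hY.const_mul _)
  refine (integral_mono_of_nonneg (Filter.Eventually.of_forall fun ω => (Real.exp_pos _).le)
    (hi.const_mul _) (Filter.Eventually.of_forall key)).trans ?_
  rw [integral_const_mul, integral_add (integrable_const _) (hY.const_mul _), integral_const_mul]
  simp only [integral_const, probReal_univ, one_smul]
  have h2 : l * Real.exp (-b) * ∫ ω, Real.exp (Y ω) ∂μ ≤ l := by
    calc _ ≤ l * Real.exp (-b) * Real.exp b := by gcongr
      _ = l := by rw [mul_assoc, ← Real.exp_add]; simp
  have h3 := Real.exp_pos (l * b + c)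
  nlinarith

/-- product step -/
lemma aux_prod (a s : ℝ) (ha1 : 1 < a) (hs : 2 ≤ s) :
    (1 - a / s) / s ^ a ≤ 1 / (s + 1) ^ a := by
  have hs0 : 0 < s := by linarith
  have h1 : 1 - a / (s + 1) ≤ (s / (s + 1)) ^ a := by
    have := one_add_mul_self_le_rpow_one_add (s := -1 / (s + 1))
      (by rw [le_div_iff₀ (by linarith)]; linarith) ha1.le
    have e : 1 + -1 / (s + 1) = s / (s + 1) := by field_simp; ring
    rw [e] at this
    refine le_trans (le_of_eq ?_) this
    ring
  have h2 : a / (s + 1) ≤ a / s := by gcongr; linarith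
  rw [Real.div_rpow hs0.le (by linarith)] at h1
  rw [div_le_iff₀ (by positivity)]
  calc _ ≤ s ^ a / (s + 1) ^ a := by linarith
    _ = _ := by ring

/-- (s+1)^a ≤ 2^a * ((s+1)/2)^2 -/
lemma aux_pow (a s : ℝ) (ha2 : a ≤ 2) (hs : 2 ≤ s) :
    (s + 1) ^ a ≤ 2 ^ a * ((s + 1) / 2) ^ 2 := by
  have h : ((s + 1) / 2) ^ a ≤ ((s + 1) / 2) ^ (2:ℝ) :=
    Real.rpow_le_rpow_of_exponent_le (by linarith) ha2
  rw [Real.rpow_two] at h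
  have e : s + 1 = 2 * ((s + 1) / 2) := by ring
  calc (s + 1) ^ a = (2 * ((s + 1) / 2)) ^ a := by rw [← e]
    _ = 2 ^ a * ((s + 1) / 2) ^ a := Real.mul_rpow (by norm_num) (by linarith)
    _ ≤ _ := by gcongr

lemma aux_one (a : ℝ) (ha1 : 1 < a) : (1:ℝ) ≤ 2 ^ a :=
  Real.one_le_rpow (by norm_num) (by linarith)

lemma step1 (a s : ℝ) (ha1 : 1 < a) (hs : 2 ≤ s) :
    (1 - a / s) * (2 ^ a / a) + 1 / s ^ 1 ≤ 2 ^ a / a := by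
  have h := aux_one a ha1
  have e : (1 - a / s) * (2 ^ a / a) = 2 ^ a / a - 2 ^ a / s := by field_simp
  rw [e, pow_one]
  have : 1 / s ≤ 2 ^ a / s := by gcongr
  linarith

lemma step2 (a s : ℝ) (ha1 : 1 < a) (hs : 2 ≤ s) :
    (1 - a / s) * (2 ^ a / ((a - 1) * s)) + 1 / s ^ 2 ≤ 2 ^ a / ((a - 1) * (s + 1)) := by
  have h := aux_one a ha1
  have h1 : 0 < a - 1 := by linarith
  have hs0 : 0 < s := by linarith
  set P : ℝ := 2 ^ a
  have e : 2 ^ a / ((a - 1) * (s + 1)) - ((1 - a / s) * (2 ^ a / ((a - 1) * s)) + 1 / s ^ 2)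
     = (P * (a * (s + 1) - s) - (a - 1) * (s + 1)) / ((a - 1) * (s + 1) * s ^ 2) := by
    change P / _ - (_ * (P / _) + _) = _
    field_simp
    ring
  have : 0 ≤ (P * (a * (s + 1) - s) - (a - 1) * (s + 1)) / ((a - 1) * (s + 1) * s ^ 2) := by
    apply div_nonneg _ (by positivity)
    nlinarith [mul_nonneg (sub_nonneg.2 h) (by nlinarith : 0 ≤ a * (s + 1) - s)]
  change _ ≤ P / ((a - 1) * (s + 1))
  change P / _ - (_ * (P / _) + _) = _ at e
  linarith

lemma step3 (a s : ℝ) (ha1 : 1 < a) (ha2 : a ≤ 2) (hs : 2 ≤ s) :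
    (1 - a / s) * (2 ^ a * Real.log s / s ^ a) + 1 / s ^ 3
      ≤ 2 ^ a * Real.log (s + 1) / (s + 1) ^ a := by
  have h := aux_one a ha1
  have hs0 : 0 < s := by linarith
  have hp := aux_prod a s ha1 hs
  have hq := aux_pow a s ha2 hs
  have hl : 0 ≤ Real.log s := Real.log_nonneg (by linarith)
  have hd : 1 / (s + 1) ≤ Real.log (s + 1) - Real.log s := by
    have := Real.one_sub_inv_le_log_of_pos (x := (s + 1) / s) (by positivity)
    rw [Real.log_div (by positivity) (by positivity)] at this
    refine le_trans (le_of_eq ?_) this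
    field_simp; ring
  have hA : 0 < (s + 1) ^ a := by positivity
  have h3 : 1 / s ^ 3 ≤ 2 ^ a * (1 / (s + 1)) / (s + 1) ^ a := by
    rw [le_div_iff₀ hA]
    calc 1 / s ^ 3 * (s + 1) ^ a ≤ 1 / s ^ 3 * (2 ^ a * ((s + 1) / 2) ^ 2) := by gcongr
      _ = 2 ^ a * ((s + 1) ^ 2 / (4 * s ^ 3)) := by field_simp; ring
      _ ≤ _ := by
        refine mul_le_mul_of_nonneg_left ?_ (by positivity)
        rw [div_le_div_iff₀ (by positivity) (by positivity)]
        nlinarith [mul_nonneg (sub_nonneg.2 hs) (sub_nonneg.2 hs), mul_nonneg (mul_nonneg (sub_nonneg.2 hs) (sub_nonneg.2 hs)) (sub_nonneg.2 hs)]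
  calc _ ≤ 2 ^ a * Real.log s * ((1 - a / s) / s ^ a) + 2 ^ a * (1 / (s + 1)) / (s + 1) ^ a := by
        refine add_le_add (le_of_eq ?_) h3
        ring
    _ ≤ 2 ^ a * Real.log s * (1 / (s + 1) ^ a)
        + 2 ^ a * (Real.log (s + 1) - Real.log s) / (s + 1) ^ a := by gcongr
    _ = _ := by ring

lemma stepj (a s K : ℝ) (n : ℕ) (hn : 1 ≤ n) (ha1 : 1 < a) (ha2 : a ≤ 2) (hs : 2 ≤ s)
    (hK : 1 / (s - 1) ^ n ≤ K) :
    (1 - a / s) * (2 ^ a * (K - 1 / (s - 1) ^ n) / (n * s ^ a)) + 1 / s ^ (n + 3)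
      ≤ 2 ^ a * (K - 1 / s ^ n) / (n * (s + 1) ^ a) := by
  have h := aux_one a ha1
  have hs0 : 0 < s := by linarith
  have hs1 : 0 < s - 1 := by linarith
  have hn0 : (0:ℝ) < n := by exact_mod_cast hn
  have hp := aux_prod a s ha1 hs
  have hq := aux_pow a s ha2 hs
  have hA : 0 < (s + 1) ^ a := by positivity
  have hd : n / s ^ (n + 1) ≤ 1 / (s - 1) ^ n - 1 / s ^ n := by
    have hb := one_add_mul_le_pow (a := 1 / (s - 1)) (by have : 0 < 1 / (s - 1) := by positivity
                                                         linarith) n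
    have e : 1 + 1 / (s - 1) = s / (s - 1) := by field_simp; ring
    rw [e, div_pow] at hb
    have h4 : (n:ℝ) * (1 / s) ≤ n * (1 / (s - 1)) := by gcongr; linarith
    have h5 : (1 + (n:ℝ) * (1 / s)) * (1 / s ^ n) ≤ s ^ n / (s - 1) ^ n * (1 / s ^ n) := by
      gcongr; linarith
    have e2 : s ^ n / (s - 1) ^ n * (1 / s ^ n) = 1 / (s - 1) ^ n := by field_simp
    have e3 : (1 + (n:ℝ) * (1 / s)) * (1 / s ^ n) = 1 / s ^ n + n / s ^ (n + 1) := by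
      field_simp
      ring
    linarith
  have h3 : 1 / s ^ (n + 3) ≤ 2 ^ a * (n / s ^ (n + 1)) / (n * (s + 1) ^ a) := by
    have e : 2 ^ a * (n / s ^ (n + 1)) / (n * (s + 1) ^ a) = (2 ^ a / s ^ (n + 1)) / (s + 1) ^ a := by
      field_simp
    rw [e, le_div_iff₀ hA]
    calc 1 / s ^ (n + 3) * (s + 1) ^ a ≤ 1 / s ^ (n + 3) * (2 ^ a * ((s + 1) / 2) ^ 2) := by gcongr
      _ ≤ 1 / s ^ (n + 3) * (2 ^ a * s ^ 2) := by gcongr; linarith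
      _ = _ := by field_simp; ring
  have hK' := sub_nonneg.2 hK
  calc _ ≤ 2 ^ a * (K - 1 / (s - 1) ^ n) / n * ((1 - a / s) / s ^ a)
          + 2 ^ a * (n / s ^ (n + 1)) / (n * (s + 1) ^ a) := by
        refine add_le_add (le_of_eq ?_) h3
        field_simp
    _ ≤ 2 ^ a * (K - 1 / (s - 1) ^ n) / n * (1 / (s + 1) ^ a)
        + 2 ^ a * (1 / (s - 1) ^ n - 1 / s ^ n) / (n * (s + 1) ^ a) := by gcongr
    _ = _ := by field_simp; ring

lemma aux_sum (M : ℕ) (C : ℕ → ℝ) (hC : ∀ i, 1 ≤ i → 0 ≤ C i) (s : ℝ) (hs : 0 < s) :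
    ∑ i ∈ Finset.Icc 1 M, C i / s ^ i ≤ C 1 * (1 / s ^ 1) + C 2 * (1 / s ^ 2) + C 3 * (1 / s ^ 3)
      + ∑ j ∈ Finset.Icc 4 M, C j * (1 / s ^ j) := by
  have hsub : Finset.Icc 1 M ⊆ insert 1 (insert 2 (insert 3 (Finset.Icc 4 M))) := by
    intro i hi
    simp only [Finset.mem_insert, Finset.mem_Icc] at *
    omega
  refine (Finset.sum_le_sum_of_subset_of_nonneg hsub ?_).trans (le_of_eq ?_)
  · intro i hi _
    have : 1 ≤ i := by
      simp only [Finset.mem_insert, Finset.mem_Icc] at hi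
      omega
    have := hC i this
    positivity
  · rw [Finset.sum_insert (by simp), Finset.sum_insert (by simp), Finset.sum_insert (by simp)]
    simp only [mul_one_div]
    ring

/-- the supersolution -/
noncomputable def auxB (a t0 X1 : ℝ) (M : ℕ) (C : ℕ → ℝ) (s : ℝ) : ℝ :=
  (t0 + 1) ^ a * X1 * (1 / s ^ a) + C 1 * (2 ^ a / a) + C 2 * (2 ^ a / ((a - 1) * s))
    + C 3 * (2 ^ a * Real.log s / s ^ a)
    + ∑ j ∈ Finset.Icc 4 M,
      C j * (2 ^ a * (1 / t0 ^ (j - 3) - 1 / (s - 1) ^ (j - 3)) / (((j - 3 : ℕ) : ℝ) * s ^ a))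

lemma auxB_step (a t0 X1 : ℝ) (M : ℕ) (C : ℕ → ℝ) (s : ℝ) (hC : ∀ i, 1 ≤ i → 0 ≤ C i)
    (ha1 : 1 < a) (ha2 : a ≤ 2) (ht0 : a ≤ t0) (hX1 : 0 < X1) (hs : t0 + 1 ≤ s) :
    (1 - a / s) * auxB a t0 X1 M C s + ∑ i ∈ Finset.Icc 1 M, C i / s ^ i
      ≤ auxB a t0 X1 M C (s + 1) := by
  have hs2 : 2 ≤ s := by linarith
  have ht : 0 < t0 := by linarith
  have h0 := mul_le_mul_of_nonneg_left (aux_prod a s ha1 hs2)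
    (by positivity : 0 ≤ (t0 + 1) ^ a * X1)
  have h1 := mul_le_mul_of_nonneg_left (step1 a s ha1 hs2) (hC 1 (by norm_num))
  have h2 := mul_le_mul_of_nonneg_left (step2 a s ha1 hs2) (hC 2 (by norm_num))
  have h3 := mul_le_mul_of_nonneg_left (step3 a s ha1 ha2 hs2) (hC 3 (by norm_num))
  have h4 : ∑ j ∈ Finset.Icc 4 M, C j * ((1 - a / s) * (2 ^ a * (1 / t0 ^ (j - 3) - 1 / (s - 1) ^ (j - 3)) / (((j - 3 : ℕ) : ℝ) * s ^ a)) + 1 / s ^ j) ≤ 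
     ∑ j ∈ Finset.Icc 4 M, C j * (2 ^ a * (1 / t0 ^ (j - 3) - 1 / (s + 1 - 1) ^ (j - 3)) / (((j - 3 : ℕ) : ℝ) * (s + 1) ^ a)) := by
    refine Finset.sum_le_sum fun j hj => ?_
    have hj4 : 4 ≤ j := (Finset.mem_Icc.1 hj).1
    refine mul_le_mul_of_nonneg_left ?_ (hC j (by omega))
    have hh := stepj a s (1 / t0 ^ (j - 3)) (j - 3) (by omega) ha1 ha2 hs2 (by
      gcongr; linarith)
    rw [Nat.sub_add_cancel (by omega : 3 ≤ j)] at hh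
    rw [add_sub_cancel_right]
    exact hh
  have h5 := aux_sum M C hC s (by linarith)
  have e4 : ∑ j ∈ Finset.Icc 4 M, C j * ((1 - a / s) * (2 ^ a * (1 / t0 ^ (j - 3) - 1 / (s - 1) ^ (j - 3)) / (((j - 3 : ℕ) : ℝ) * s ^ a)) + 1 / s ^ j) = (1 - a / s) * (∑ j ∈ Finset.Icc 4 M, C j * (2 ^ a * (1 / t0 ^ (j - 3) - 1 / (s - 1) ^ (j - 3)) / (((j - 3 : ℕ) : ℝ) * s ^ a))) + ∑ j ∈ Finset.Icc 4 M, C j * (1 / s ^ j) := by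
    rw [Finset.mul_sum, ← Finset.sum_add_distrib]
    exact Finset.sum_congr rfl fun j _ => by ring
  rw [e4] at h4
  unfold auxB
  have e0 : (t0 + 1) ^ a * X1 * ((1 - a / s) / s ^ a) = (1 - a / s) * ((t0 + 1) ^ a * X1 * (1 / s ^ a)) := by ring
  rw [e0] at h0
  linarith

/-- MGF bound for an "almost decreasing" stochastic process (Lemma 5). -/
theorem mgf_almost_decreasing_bound
    {Ω : Type*} {mΩ : MeasurableSpace Ω} (μ : Measure Ω) [IsProbabilityMeasure μ]
    (a t0 : ℝ) (ha1 : 1 < a) (ha2 : a ≤ 2) (ht0 : a ≤ t0)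
    (M : ℕ) (hM : 1 ≤ M) (C : ℕ → ℝ)
    (hCpos : ∀ i ∈ Finset.Icc 1 M, 0 < C i)
    (hCzero : ∀ i, M < i → C i = 0)
    (X : ℕ → Ω → ℝ) (X1 : ℝ) (hX1pos : 0 < X1) (hX1 : ∀ ω, X 1 ω = X1)
    (hint : ∀ t, Integrable (fun ω => Real.exp (X t ω)) μ)
    (hrec : ∀ t : ℕ, 1 ≤ t →
      ∫ ω, Real.exp (X (t + 1) ω) ∂μ ≤
        ∫ ω, Real.exp ((1 - a / ((t : ℝ) + t0)) * X t ω
          + ∑ i ∈ Finset.Icc 1 M, C i / ((t : ℝ) + t0) ^ i) ∂μ) :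
    ∀ t : ℕ, 1 ≤ t →
      ∫ ω, Real.exp (X (t + 1) ω) ∂μ ≤
        Real.exp ((t0 + 1) ^ a * X1 / ((t : ℝ) + 1 + t0) ^ a
          + 2 ^ a * C 1 / a
          + 2 ^ a * C 2 / ((a - 1) * ((t : ℝ) + 1 + t0))
          + 2 ^ a * C 3 * Real.log ((t : ℝ) + 1 + t0) / ((t : ℝ) + 1 + t0) ^ a
          + ∑ j ∈ Finset.Icc 4 M,
              2 ^ a * t0 ^ (3 - (j : ℝ)) * C j / (((j : ℝ) - 3) * ((t : ℝ) + 1 + t0) ^ a)) := by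
  have hC : ∀ i, 1 ≤ i → 0 ≤ C i := by
    intro i hi
    by_cases h : i ≤ M
    · exact (hCpos i (Finset.mem_Icc.2 ⟨hi, h⟩)).le
    · exact (hCzero i (by omega)).ge
  have ht : 0 < t0 := by linarith
  have main : ∀ t : ℕ, 1 ≤ t →
      ∫ ω, Real.exp (X t ω) ∂μ ≤ Real.exp (auxB a t0 X1 M C ((t : ℝ) + t0)) := by
    intro t h1
    induction t, h1 using Nat.le_induction with
    | base =>
      simp only [hX1, integral_const, probReal_univ, one_smul, Real.exp_le_exp]
      unfold auxB
      have c1 := hC 1 (by norm_num)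
      have c2 := hC 2 (by norm_num)
      have c3 := hC 3 (by norm_num)
      have e : (t0 + 1) ^ a * X1 * (1 / (((1 : ℕ) : ℝ) + t0) ^ a) = X1 := by
        push_cast
        rw [add_comm 1 t0]
        field_simp
      have e4 : ∑ j ∈ Finset.Icc 4 M, C j * (2 ^ a * (1 / t0 ^ (j - 3)
          - 1 / (((1 : ℕ) : ℝ) + t0 - 1) ^ (j - 3))
          / (((j - 3 : ℕ) : ℝ) * (((1 : ℕ) : ℝ) + t0) ^ a)) = 0 := by
        refine Finset.sum_eq_zero fun j _ => ?_
        simp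
      rw [e, e4]
      have a1 : 0 < a - 1 := by linarith
      have hl : 0 ≤ Real.log (((1 : ℕ) : ℝ) + t0) := Real.log_nonneg (by push_cast; linarith)
      have p1 : 0 ≤ C 1 * (2 ^ a / a) := by positivity
      have p2 : 0 ≤ C 2 * (2 ^ a / ((a - 1) * (((1 : ℕ) : ℝ) + t0))) := by positivity
      have p3 : 0 ≤ C 3 * (2 ^ a * Real.log (((1 : ℕ) : ℝ) + t0) / (((1 : ℕ) : ℝ) + t0) ^ a) := by
        positivity
      linarith
    | succ t h1 ih =>
      have ht1 : (1 : ℝ) ≤ t := by exact_mod_cast h1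
      refine (hrec t h1).trans ?_
      refine (aux_jensen μ (X t) (hint t) _ _ _ ?_ ?_ ih).trans ?_
      · rw [sub_nonneg, div_le_one (by linarith)]; linarith
      · have : 0 ≤ a / ((t : ℝ) + t0) := by positivity
        linarith
      · rw [Real.exp_le_exp]
        have := auxB_step a t0 X1 M C ((t : ℝ) + t0) hC ha1 ha2 ht0 hX1pos (by linarith)
        push_cast
        rw [show (t : ℝ) + 1 + t0 = (t : ℝ) + t0 + 1 by ring]
        exact this
  intro t h1
  refine (main (t + 1) (by omega)).trans ?_
  rw [Real.exp_le_exp]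
  push_cast
  have ht1 : (1 : ℝ) ≤ t := by exact_mod_cast h1
  unfold auxB
  refine add_le_add (le_of_eq (by ring)) (Finset.sum_le_sum fun j hj => ?_)
  have hj4 : 4 ≤ j := (Finset.mem_Icc.1 hj).1
  obtain ⟨n, rfl⟩ : ∃ n, j = n + 3 := ⟨j - 3, by omega⟩
  have hn : (0 : ℝ) < n := by
    have : 0 < n := by omega
    exact_mod_cast this
  have hc := hC (n + 3) (by omega)
  have e1 : t0 ^ (3 - ((n + 3 : ℕ) : ℝ)) = 1 / t0 ^ n := by
    rw [show (3 - ((n + 3 : ℕ) : ℝ)) = -(n : ℝ) by push_cast; ring, Real.rpow_neg ht.le,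
      Real.rpow_natCast, one_div]
  rw [e1, Nat.add_sub_cancel, show (((n + 3 : ℕ) : ℝ) - 3) = n by push_cast; ring]
  have hp : 0 ≤ 1 / ((t : ℝ) + 1 + t0 - 1) ^ n := by
    have : 0 < (t : ℝ) + 1 + t0 - 1 := by linarith
    positivity
  calc _ ≤ C (n + 3) * (2 ^ a * (1 / t0 ^ n) / (n * ((t : ℝ) + 1 + t0) ^ a)) := by
        gcongr
        linarith
    _ = _ := by ring
end

section
/- Let λ ∈ [0,1), a, t_0 > 0, c ≥ 1/2, and define α_t = a/(t+t_0)^c for t ≥ 1. If t_0 ≥ (2c − 1 + λ)/(1 − λ), then for every t ≥ 1: ∑_{k=1}^t α_k λ^{t−k} ≤ 3α_t/(1 − λ). -/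
/-- Geometrically weighted sums of polynomially decaying step sizes
`α_t = a / (t + t₀)^c` are bounded by `3 α_t / (1 - λ)`. -/
theorem geom_weighted_stepsize_sum_le
    (lam : ℝ) (hlam0 : 0 ≤ lam) (hlam1 : lam < 1)
    (a t0 c : ℝ) (ha : 0 < a) (ht0pos : 0 < t0) (hc : 1 / 2 ≤ c)
    (α : ℕ → ℝ) (hα : ∀ t : ℕ, α t = a / ((t : ℝ) + t0) ^ c)
    (ht0 : (2 * c - 1 + lam) / (1 - lam) ≤ t0) :
    ∀ t : ℕ, 1 ≤ t →
      ∑ k ∈ Finset.Icc 1 t, α k * lam ^ (t - k) ≤ 3 * α t / (1 - lam) := by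
  have h1 : 0 < 1 - lam := by linarith
  have hαpos : ∀ t, 0 < α t := by
    intro t
    rw [hα]
    positivity
  have key : ∀ t : ℕ, 1 ≤ t → 3 * lam * α t ≤ (2 + lam) * α (t + 1) := by
    intro t ht
    rw [hα, hα]
    have ht' : (1 : ℝ) ≤ t := by exact_mod_cast ht
    rw [div_le_iff₀ h1] at ht0
    push_cast
    have e : (t : ℝ) + 1 + t0 = (t + t0) + 1 := by ring
    rw [e]
    have hs0 : 0 < (t : ℝ) + t0 := by linarith
    have hs : 2 * c ≤ (t + t0) * (1 - lam) := by nlinarith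
    generalize (t : ℝ) + t0 = s at hs0 hs
    have hE : (s + 1) ^ c ≤ s ^ c * Real.exp ((1 - lam) / 2) := by
      have h2 : s + 1 ≤ s * Real.exp (1 / s) := by
        have h3 := Real.add_one_le_exp (1 / s)
        have h4 := mul_le_mul_of_nonneg_left h3 hs0.le
        have h5 : s * (1 / s + 1) = s + 1 := by field_simp; ring
        linarith
      have h6 : (s + 1) ^ c ≤ (s * Real.exp (1 / s)) ^ c :=
        Real.rpow_le_rpow (by linarith) h2 (by linarith)
      rw [Real.mul_rpow hs0.le (Real.exp_pos _).le, ← Real.exp_mul] at h6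
      refine h6.trans ?_
      gcongr
      rw [one_div_mul_eq_div, div_le_div_iff₀ hs0 (by norm_num)]
      linarith
    have hb : Real.exp ((1 - lam) / 2) * ((1 + lam) / 2) ≤ 1 := by
      have h3 := Real.add_one_le_exp (-((1 - lam) / 2))
      calc _ ≤ Real.exp ((1 - lam) / 2) * Real.exp (-((1 - lam) / 2)) := by
            gcongr
            linarith
        _ = 1 := by rw [← Real.exp_add]; simp
    have hE0 := Real.exp_pos ((1 - lam) / 2)
    generalize Real.exp ((1 - lam) / 2) = E at hE hb hE0
    have hq : 3 * lam * E ≤ 2 + lam := by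
      nlinarith [mul_nonneg hE0.le (mul_nonneg h1.le (by linarith : 0 ≤ 2 - lam))]
    have hp : 0 < s ^ c := by positivity
    have hp1 : 0 < (s + 1) ^ c := by positivity
    rw [← mul_div_assoc, ← mul_div_assoc, div_le_div_iff₀ hp hp1]
    calc 3 * lam * a * (s + 1) ^ c ≤ 3 * lam * a * (s ^ c * E) := by gcongr
      _ = (3 * lam * E) * (a * s ^ c) := by ring
      _ ≤ (2 + lam) * (a * s ^ c) := by gcongr
      _ = _ := by ring
  intro t ht
  induction t, ht using Nat.le_induction with
  | base =>
    have := hαpos 1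
    rw [le_div_iff₀ h1]
    simp
    nlinarith
  | succ t ht ih =>
    have hsum : ∑ k ∈ Finset.Icc 1 (t + 1), α k * lam ^ (t + 1 - k)
        = lam * ∑ k ∈ Finset.Icc 1 t, α k * lam ^ (t - k) + α (t + 1) := by
      rw [Finset.sum_Icc_succ_top (by omega), Finset.mul_sum]
      congr 1
      · refine Finset.sum_congr rfl fun k hk => ?_
        rw [Finset.mem_Icc] at hk
        rw [Nat.succ_sub hk.2, pow_succ]
        ring
      · simp
    rw [hsum]
    rw [le_div_iff₀ h1] at ih ⊢
    have hk := key t ht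
    have := mul_le_mul_of_nonneg_left ih hlam0
    linarith
end

section
/- For every real number a: exp(a) ≤ a + exp(9a²/16). -/
theorem exp_le_add_exp_sq (a : ℝ) : Real.exp a ≤ a + Real.exp (9 * a ^ 2 / 16) := by
  rcases le_or_gt a 0 with h0 | h0
  · have h1 : Real.exp a ≤ 1 + a + a^2/2 := by
      have h := Real.quadratic_le_exp_of_nonneg (x := -a) (by linarith)
      have hp : Real.exp a * Real.exp (-a) = 1 := by rw [← Real.exp_add]; simp
      have hq : 0 < 1 + a + a^2/2 := by nlinarith [sq_nonneg (a+1)]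
      have h2 : (1 + a + a^2/2) * (1 + -a + (-a)^2/2) ≤ (1 + a + a^2/2) * Real.exp (-a) :=
        mul_le_mul_of_nonneg_left h hq.le
      have h3 : 1 ≤ (1 + a + a^2/2) * Real.exp (-a) := by nlinarith [sq_nonneg (a^2)]
      have := Real.exp_pos (-a)
      by_contra hc
      push Not at hc
      nlinarith
    have h2 := Real.add_one_le_exp (9 * a^2/16)
    nlinarith [sq_nonneg a]
  rcases le_or_gt a 1 with h1 | h1
  · have hu := Real.exp_bound' h0.le h1 (n := 6) (by norm_num)
    have hl := Real.sum_le_exp_of_nonneg (x := 9 * a^2/16) (by positivity) 4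
    simp only [Finset.sum_range_succ, Finset.sum_range_zero, Nat.factorial] at hu hl
    norm_num at hu hl
    have key : 0 ≤ a^2 * (1/16 - a/6 + (81/512-1/24)*a^2 - a^3/120 + (729/24576 - 7/4320)*a^4) := by
      apply mul_nonneg (sq_nonneg a)
      nlinarith [sq_nonneg (a^2 - 3/20*a), sq_nonneg (a - 18/25)]
    nlinarith
  · rcases le_or_gt (16/9) a with h2 | h2
    · have : Real.exp a ≤ Real.exp (9 * a^2/16) := Real.exp_le_exp.2 (by nlinarith)
      linarith
    obtain ⟨t, rfl⟩ : ∃ t, a = 1 + t := ⟨a - 1, by ring⟩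
    have ht0 : 0 < t := by linarith
    have ht1 : t < 7/9 := by linarith
    obtain ⟨w, hw⟩ : ∃ w, w = (7 - 9*t)/16 := ⟨_, rfl⟩
    obtain ⟨u, hu⟩ : ∃ u, u = (1+t)*w := ⟨_, rfl⟩
    have hw0 : 0 < w := by linarith
    have hu0 : 0 < u := by rw [hu]; positivity
    have hu1 : u ≤ 7/16 := by rw [hu, hw]; nlinarith
    have hlow : 1 - u + u^2/2 - u^3/6 ≤ Real.exp (-u) := by
      have h := Real.exp_bound' hu0.le (by linarith) (n := 4) (by norm_num)
      simp only [Finset.sum_range_succ, Finset.sum_range_zero, Nat.factorial] at h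
      norm_num at h
      have hp : Real.exp u * Real.exp (-u) = 1 := by rw [← Real.exp_add]; simp
      have hq : 0 < 1 - u + u^2/2 - u^3/6 := by nlinarith [pow_pos hu0 2]
      have h2 := mul_le_mul_of_nonneg_left h hq.le
      have h3 : (1 - u + u^2/2 - u^3/6) * Real.exp u ≤ 1 := by
        refine h2.trans ?_
        nlinarith [pow_pos hu0 4, pow_pos hu0 5, pow_pos hu0 6, pow_pos hu0 7]
      have := Real.exp_pos u
      by_contra hc
      push Not at hc
      nlinarith
    have hsplit : Real.exp (9 * (1+t)^2/16) = Real.exp (1+t) * Real.exp (-u) := by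
      rw [← Real.exp_add, hu, hw]; congr 1; ring
    have hE := Real.exp_pos (1+t)
    have hEw : Real.exp (1+t) * w * (1 + 2*t/7) ≤ 1.1893 := by
      have e1 := Real.add_one_le_exp (-(9*t/7))
      have e2 := Real.add_one_le_exp (2*t/7)
      have hm : w * (1 + 2*t/7) ≤ 7/16 * Real.exp (-(9*t/7)) * Real.exp (2*t/7) := by
        apply mul_le_mul <;> first | positivity | linarith
      have hx : Real.exp (1+t) * (Real.exp (-(9*t/7)) * Real.exp (2*t/7)) = Real.exp 1 := by
        rw [← Real.exp_add, ← Real.exp_add]; congr 1; ring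
      have := mul_le_mul_of_nonneg_left hm hE.le
      have := Real.exp_one_lt_d9
      norm_num at *
      nlinarith
    have hQ : 1.1893 * (1 - u/2 + u^2/6) ≤ 1 + 2*t/7 := by
      have : u^2 ≤ 7/16*u := by nlinarith
      have hu' : u = (7 - 2*t - 9*t^2)/16 := by rw [hu, hw]; ring
      nlinarith
    have hQ0 : 0 < 1 - u/2 + u^2/6 := by nlinarith [sq_nonneg u]
    have hfin : Real.exp (1+t) * w * (1 - u/2 + u^2/6) ≤ 1 := by
      have hs : 0 < 1 + 2*t/7 := by positivity
      have := mul_le_mul_of_nonneg_right hEw hQ0.le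
      have := this.trans hQ
      by_contra hc
      push Not at hc
      nlinarith
    have h5 := mul_le_mul_of_nonneg_left hlow hE.le
    have h6 := mul_le_mul_of_nonneg_left hfin (show (0:ℝ) ≤ 1 + t by linarith)
    have h7 : (1+t) * (Real.exp (1+t) * w * (1 - u/2 + u^2/6)) = Real.exp (1+t) * (u - u^2/2 + u^3/6) := by
      rw [show u - u^2/2 + u^3/6 = u * (1 - u/2 + u^2/6) by ring]
      nth_rewrite 3 [hu]
      ring
    rw [hsplit]
    nlinarith
end

section
/- Let f : ℝ^d → ℝ be differentiable with L-Lipschitz continuous gradient and bounded below, with f* = inf_{x ∈ ℝ^d} f(x) > −∞. Let x_1, …, x_n ∈ ℝ^d with x̄ = (1/n)∑_{i=1}^n x_i. Then (1/n)∑_{i=1}^n (f(x_i) − f*) ≤ 2(f(x̄) − f*) + (L/n)∑_{i=1}^n ‖x_i − x̄‖². -/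
theorem smooth_upper_aux {d : ℕ} (L : ℝ) (hL : 0 ≤ L)
    (f : EuclideanSpace ℝ (Fin d) → ℝ)
    (hdiff : Differentiable ℝ f)
    (hlip : ∀ x y, ‖gradient f x - gradient f y‖ ≤ L * ‖x - y‖)
    (a y : EuclideanSpace ℝ (Fin d)) :
    f y ≤ f a + fderiv ℝ f a (y - a) + L * ‖y - a‖ ^ 2 := by
  have h := (convex_segment (𝕜 := ℝ) a y).norm_image_sub_le_of_norm_fderiv_le'
    (f := f) (φ := fderiv ℝ f a) (C := L * ‖y - a‖) (x := a) (y := y)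
    (fun z _ => hdiff z) (fun z hz => ?_) (left_mem_segment ℝ a y) (right_mem_segment ℝ a y)
  · have h2 := (le_abs_self _).trans h
    nlinarith
  · have h1 := hlip z a
    unfold gradient at h1
    rw [← map_sub, LinearIsometryEquiv.norm_map] at h1
    refine h1.trans (mul_le_mul_of_nonneg_left ?_ hL)
    obtain ⟨t, ht, rfl⟩ := (segment_eq_image' ℝ a y) ▸ hz
    simp only [add_sub_cancel_left, norm_smul, Real.norm_eq_abs, abs_of_nonneg ht.1]
    exact mul_le_of_le_one_left (norm_nonneg _) ht.2

/-- For a smooth function bounded below, the average optimality gap over points `xᵢ`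
is controlled by the gap at the average point plus the consensus gap:
`(1/n) ∑ᵢ (f(xᵢ) − f*) ≤ 2(f(x̄) − f*) + (L/n) ∑ᵢ ‖xᵢ − x̄‖²`. -/
theorem avg_optimality_gap_le
    {d n : ℕ} (hn : 0 < n) (L : ℝ) (hL : 0 ≤ L)
    (f : EuclideanSpace ℝ (Fin d) → ℝ)
    (hdiff : Differentiable ℝ f)
    (hlip : ∀ x y, ‖gradient f x - gradient f y‖ ≤ L * ‖x - y‖)
    (hbdd : BddBelow (Set.range f))
    (fstar : ℝ) (hfstar : fstar = ⨅ x, f x)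
    (x : Fin n → EuclideanSpace ℝ (Fin d))
    (xbar : EuclideanSpace ℝ (Fin d))
    (hxbar : xbar = (n : ℝ)⁻¹ • ∑ i, x i) :
    (1 / n) * ∑ i, (f (x i) - fstar) ≤
      2 * (f xbar - fstar) + (L / n) * ∑ i, ‖x i - xbar‖ ^ 2 := by
  have hn' : (0 : ℝ) < n := by exact_mod_cast hn
  have hge : fstar ≤ f xbar := hfstar ▸ ciInf_le hbdd xbar
  have hz : ∑ i, (x i - xbar) = 0 := by
    rw [Finset.sum_sub_distrib, Finset.sum_const, Finset.card_univ, Fintype.card_fin, hxbar,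
      ← Nat.cast_smul_eq_nsmul ℝ, smul_smul, mul_inv_cancel₀ hn'.ne', one_smul, sub_self]
  have hs : ∑ i, (f (x i) - fstar) ≤
      ∑ i, ((f xbar - fstar) + fderiv ℝ f xbar (x i - xbar) + L * ‖x i - xbar‖ ^ 2) :=
    Finset.sum_le_sum fun i _ => by
      have := smooth_upper_aux L hL f hdiff hlip xbar (x i)
      linarith
  rw [Finset.sum_add_distrib, Finset.sum_add_distrib, ← map_sum, hz, map_zero, add_zero,
    ← Finset.mul_sum, Finset.sum_const, Finset.card_univ, Fintype.card_fin, nsmul_eq_mul] at hs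
  calc (1 / n) * ∑ i, (f (x i) - fstar)
      ≤ (1 / n) * (n * (f xbar - fstar) + L * ∑ i, ‖x i - xbar‖ ^ 2) :=
        mul_le_mul_of_nonneg_left hs (by positivity)
    _ = (f xbar - fstar) + (L / n) * ∑ i, ‖x i - xbar‖ ^ 2 := by
        field_simp
    _ ≤ _ := by linarith
end
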